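/- (Vanishing gradient mapping at the extrapolated points.) Under the relaxed FISTA setup with step size 0 < γ ≤ (1 − α²)/(2L), and assuming F* := inf_{x∈ℝ^N} F(x) > −∞, the gradient-mapping norms at the extrapolated points converge to zero: lim_{k→∞} ‖G_γ(s_k)‖ = 0, where G_γ(x) = (x − prox_{γR}(x − γ∇D(x)))/γ. Equivalently, lim_{k→∞} ‖s_k − f_k‖ = 0. -/

import Mathlib

open scoped RealInnerProductSpace

/-- The gradient mapping `G_γ(x) = (x - prox_{γR}(x - γ∇D(x)))/γ`. -/
noncomputable def gradMap {N : ℕ} (γ : ℝ)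
    (gradD : EuclideanSpace ℝ (Fin N) → EuclideanSpace ℝ (Fin N))
    (prox : EuclideanSpace ℝ (Fin N) → EuclideanSpace ℝ (Fin N))
    (x : EuclideanSpace ℝ (Fin N)) : EuclideanSpace ℝ (Fin N) :=
  γ⁻¹ • (x - prox (x - γ • gradD x))

section Helpers

variable {E : Type*} [NormedAddCommGroup E] [InnerProductSpace ℝ E]

/-- The descent lemma: the quadratic upper bound for a function with Lipschitz gradient. -/
theorem descent_of_lipschitz_gradient [CompleteSpace E] {D : E → ℝ} {g : E → E}
    (hD : ∀ x, HasGradientAt D (g x) x) {L : ℝ}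
    (hLip : ∀ x y, ‖g x - g y‖ ≤ L * ‖x - y‖) (x y : E) :
    D y ≤ D x + ⟪g x, y - x⟫ + L / 2 * ‖y - x‖ ^ 2 := by
  set v := y - x with hv
  have hderiv : ∀ u : ℝ, HasDerivAt
      (fun u : ℝ => D (x + u • v) - u * ⟪g x, v⟫ - u ^ 2 * (L / 2 * ‖v‖ ^ 2))
      (⟪g (x + u • v), v⟫ - ⟪g x, v⟫ - 2 * u * (L / 2 * ‖v‖ ^ 2)) u := by
    intro u
    have hline : HasDerivAt (fun u : ℝ => x + u • v) v u := by
      simpa using ((hasDerivAt_id u).smul_const v).const_add x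
    have hcomp := (hD (x + u • v)).hasFDerivAt.comp_hasDerivAt u hline
    simp only [InnerProductSpace.toDual_apply_apply] at hcomp
    have hlin : HasDerivAt (fun u : ℝ => u * ⟪g x, v⟫) ⟪g x, v⟫ u := by
      simpa using (hasDerivAt_id u).mul_const ⟪g x, v⟫
    have hsq : HasDerivAt (fun u : ℝ => u ^ 2 * (L / 2 * ‖v‖ ^ 2))
        (2 * u * (L / 2 * ‖v‖ ^ 2)) u := by
      simpa using (hasDerivAt_pow 2 u).mul_const (L / 2 * ‖v‖ ^ 2)
    exact (hcomp.sub hlin).sub hsq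
  have hanti : AntitoneOn
      (fun u : ℝ => D (x + u • v) - u * ⟪g x, v⟫ - u ^ 2 * (L / 2 * ‖v‖ ^ 2))
      (Set.Icc 0 1) := by
    refine antitoneOn_of_deriv_nonpos (convex_Icc 0 1)
      (fun u _ => (hderiv u).continuousAt.continuousWithinAt)
      (fun u _ => (hderiv u).differentiableAt.differentiableWithinAt) fun u hu => ?_
    rw [(hderiv u).deriv, ← inner_sub_left]
    rw [interior_Icc] at hu
    have hg : ‖g (x + u • v) - g x‖ ≤ L * (u * ‖v‖) := by
      have := hLip (x + u • v) x
      rwa [add_sub_cancel_left, norm_smul, Real.norm_of_nonneg hu.1.le] at this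
    have hcs := real_inner_le_norm (g (x + u • v) - g x) v
    nlinarith [mul_le_mul_of_nonneg_right hg (norm_nonneg v)]
  have h01 := hanti (Set.left_mem_Icc.2 zero_le_one) (Set.right_mem_Icc.2 zero_le_one) zero_le_one
  simp only [one_smul, zero_smul, add_zero, hv, add_sub_cancel] at h01
  linarith

/-- The quadratic lower bound for a function with Lipschitz gradient. -/
theorem quadratic_lower_bound_of_lipschitz_gradient [CompleteSpace E] {D : E → ℝ} {g : E → E}
    (hD : ∀ x, HasGradientAt D (g x) x) {L : ℝ}
    (hLip : ∀ x y, ‖g x - g y‖ ≤ L * ‖x - y‖) (x y : E) :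
    D x + ⟪g x, y - x⟫ - L / 2 * ‖y - x‖ ^ 2 ≤ D y := by
  have hneg : ∀ x, HasGradientAt (fun x => -D x) (-g x) x := by
    intro x
    rw [hasGradientAt_iff_hasFDerivAt, map_neg]
    exact (hD x).hasFDerivAt.neg
  have := descent_of_lipschitz_gradient hneg (L := L)
    (fun x y => by rw [← norm_neg]; simpa [add_comm, sub_eq_add_neg] using hLip x y) x y
  rw [inner_neg_left] at this
  linarith

/-- The variational inequality for a minimizer `p` of `R + c‖· - w‖²` with `R` convex. -/
theorem sub_le_inner_of_prox {R : E → EReal}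
    (hR : ∀ x y : E, ∀ a b : ℝ, 0 ≤ a → 0 ≤ b → a + b = 1 →
      R (a • x + b • y) ≤ (a : EReal) * R x + (b : EReal) * R y)
    {c : ℝ} {w p z : E} {rp rz : ℝ} (hrp : R p = rp) (hrz : R z = rz)
    (hmin : ∀ z, R p + ((c * ‖p - w‖ ^ 2 : ℝ) : EReal) ≤ R z + ((c * ‖z - w‖ ^ 2 : ℝ) : EReal)) :
    rp - rz ≤ 2 * c * ⟪p - w, z - p⟫ := by
  have key : ∀ l : ℝ, l ∈ Set.Ioc (0 : ℝ) 1 →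
      rp - rz ≤ 2 * c * ⟪p - w, z - p⟫ + l * (c * ‖z - p‖ ^ 2) := by
    rintro l ⟨hl0, hl1⟩
    have h := (hmin ((1 - l) • p + l • z)).trans
      (add_le_add_left (hR p z (1 - l) l (by linarith) hl0.le (by ring)) _)
    rw [hrp, hrz] at h
    norm_cast at h
    have hpt : (1 - l) • p + l • z - w = (p - w) + l • (z - p) := by module
    rw [hpt, norm_add_sq_real, norm_smul, real_inner_smul_right, mul_pow, Real.norm_eq_abs,
      sq_abs] at h
    refine le_of_mul_le_mul_left ?_ hl0
    linarith
  have hlim : Filter.Tendsto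
      (fun l : ℝ => 2 * c * ⟪p - w, z - p⟫ + l * (c * ‖z - p‖ ^ 2)) (nhdsWithin 0 (Set.Ioi 0))
      (nhds (2 * c * ⟪p - w, z - p⟫)) := by
    have : Continuous (fun l : ℝ => 2 * c * ⟪p - w, z - p⟫ + l * (c * ‖z - p‖ ^ 2)) := by
      fun_prop
    simpa using (this.tendsto 0).mono_left nhdsWithin_le_nhds
  exact ge_of_tendsto hlim
    (Filter.eventually_of_mem (Ioc_mem_nhdsGT zero_lt_one) key)

/-- One proximal gradient step from `s`, compared with an arbitrary point `z`. -/
theorem prox_gradient_step_le [CompleteSpace E] {D : E → ℝ} {g : E → E}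
    (hD : ∀ x, HasGradientAt D (g x) x) {L : ℝ}
    (hLip : ∀ x y, ‖g x - g y‖ ≤ L * ‖x - y‖) {R : E → EReal}
    (hR : ∀ x y : E, ∀ a b : ℝ, 0 ≤ a → 0 ≤ b → a + b = 1 →
      R (a • x + b • y) ≤ (a : EReal) * R x + (b : EReal) * R y)
    {γ : ℝ} (hγ : 0 < γ) {s p z : E} {rp rz : ℝ} (hrp : R p = rp) (hrz : R z = rz)
    (hmin : ∀ z, R p + ((1 / (2 * γ) * ‖p - (s - γ • g s)‖ ^ 2 : ℝ) : EReal) ≤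
      R z + ((1 / (2 * γ) * ‖z - (s - γ • g s)‖ ^ 2 : ℝ) : EReal)) :
    D p + rp + 1 / (2 * γ) * ‖p - z‖ ^ 2 + (1 / (2 * γ) - L / 2) * ‖s - p‖ ^ 2 ≤
      D z + rz + (1 / (2 * γ) + L / 2) * ‖s - z‖ ^ 2 := by
  have hprox := sub_le_inner_of_prox hR hrp hrz hmin
  have hup := descent_of_lipschitz_gradient hD hLip s p
  have hlow := quadratic_lower_bound_of_lipschitz_gradient hD hLip s z
  have h1 : p - (s - γ • g s) = (p - s) + γ • g s := by abel
  have h2 : z - p = (z - s) - (p - s) := by abel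
  rw [h1, h2, inner_add_left, real_inner_smul_left, inner_sub_right _ (z - s) (p - s),
    inner_sub_right _ (z - s) (p - s), real_inner_self_eq_norm_sq] at hprox
  have h3 : ‖p - z‖ ^ 2 = ‖p - s‖ ^ 2 - 2 * ⟪p - s, z - s⟫ + ‖z - s‖ ^ 2 := by
    rw [← norm_sub_sq_real, sub_sub_sub_cancel_right]
  rw [h3, norm_sub_rev s p, norm_sub_rev s z]
  have h4 : 2 * (1 / (2 * γ)) * (⟪p - s, z - s⟫ - ‖p - s‖ ^ 2 +
      γ * (⟪g s, z - s⟫ - ⟪g s, p - s⟫)) =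
      2 * (1 / (2 * γ)) * (⟪p - s, z - s⟫ - ‖p - s‖ ^ 2) + (⟪g s, z - s⟫ - ⟪g s, p - s⟫) := by
    field_simp
  rw [h4] at hprox
  linarith

end Helpers

/-- The FISTA momentum factor lies in `[0, 1]`. -/
theorem fista_momentum_mem_Icc {t : ℕ → ℝ} (ht0 : t 0 = 1)
    (htrec : ∀ k, t (k + 1) = (Real.sqrt (4 * t k ^ 2 + 1) + 1) / 2) (k : ℕ) :
    (t k - 1) / t (k + 1) ∈ Set.Icc (0 : ℝ) 1 := by
  have hle : ∀ k, t k ≤ t (k + 1) := by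
    intro k
    have : 2 * t k ≤ Real.sqrt (4 * t k ^ 2 + 1) := Real.le_sqrt_of_sq_le (by nlinarith)
    rw [htrec]
    linarith
  have hone : 1 ≤ t k := ht0 ▸ monotone_nat_of_le_succ hle (Nat.zero_le k)
  have := hle k
  exact ⟨div_nonneg (by linarith) (by linarith), (div_le_one (by linarith)).2 (by linarith)⟩

/-- A nonnegative sequence dominated by the decrements of a sequence bounded below tends to `0`. -/
theorem tendsto_zero_of_le_decrement {V a : ℕ → ℝ} {m : ℝ} (hm : ∀ k, m ≤ V k)
    (ha : ∀ k, 0 ≤ a k) (h : ∀ k, V (k + 1) + a k ≤ V k) :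
    Filter.Tendsto a Filter.atTop (nhds 0) := by
  have hV := tendsto_atTop_ciInf (antitone_nat_of_succ_le fun k => by linarith [h k, ha k])
    ⟨m, Set.forall_mem_range.2 hm⟩
  have hdiff := hV.sub (hV.comp (Filter.tendsto_add_atTop_nat 1))
  rw [sub_self] at hdiff
  exact squeeze_zero ha (fun k => by simp only [Function.comp]; linarith [h k]) hdiff

/-- Vanishing gradient mapping at the extrapolated points of relaxed FISTA with step size
`0 < γ ≤ (1 - α²)/(2L)`: if `F* = inf F > -∞`, then `‖G_γ(s_k)‖ → 0`; equivalently
`‖s_k - f_k‖ → 0`. -/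
theorem stmt17 (N : ℕ)
    (D : EuclideanSpace ℝ (Fin N) → ℝ)
    (gradD : EuclideanSpace ℝ (Fin N) → EuclideanSpace ℝ (Fin N))
    (hdiff : ∀ x, HasGradientAt D (gradD x) x)
    (L : ℝ) (hL : 0 < L) (hLip : ∀ x y, ‖gradD x - gradD y‖ ≤ L * ‖x - y‖)
    (R : EuclideanSpace ℝ (Fin N) → EReal)
    (hRproper : ∃ x, R x ≠ ⊤) (hRbot : ∀ x, R x ≠ ⊥)
    (hRconvex : ∀ x y : EuclideanSpace ℝ (Fin N), ∀ a b : ℝ, 0 ≤ a → 0 ≤ b → a + b = 1 →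
      R (a • x + b • y) ≤ (a : EReal) * R x + (b : EReal) * R y)
    (hRlsc : LowerSemicontinuous R)
    (F : EuclideanSpace ℝ (Fin N) → EReal) (hF : ∀ x, F x = (D x : EReal) + R x)
    (γ α : ℝ) (hγ0 : 0 < γ) (hγ : γ ≤ (1 - α ^ 2) / (2 * L)) (hα0 : 0 ≤ α) (hα1 : α < 1)
    (prox : EuclideanSpace ℝ (Fin N) → EuclideanSpace ℝ (Fin N))
    -- `prox x` is the unique minimizer of `z ↦ R(z) + (1/(2γ))‖z - x‖²`
    (hprox : ∀ x p, p = prox x ↔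
      ∀ z, R p + ((1 / (2 * γ) * ‖p - x‖ ^ 2 : ℝ) : EReal) ≤
        R z + ((1 / (2 * γ) * ‖z - x‖ ^ 2 : ℝ) : EReal))
    (t : ℕ → ℝ) (ht0 : t 0 = 1)
    (htrec : ∀ k, t (k + 1) = (Real.sqrt (4 * t k ^ 2 + 1) + 1) / 2)
    (f s : ℕ → EuclideanSpace ℝ (Fin N))
    (hF0 : F (f 0) ≠ ⊤)
    (hs1 : s 1 = f 0)
    (hfk : ∀ k, 1 ≤ k → f k = prox (s k - γ • gradD (s k)))
    (hsk : ∀ k, 1 ≤ k → s (k + 1) = f k + (α * ((t k - 1) / t (k + 1))) • (f k - f (k - 1)))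
    (Fstar : EReal) (hFstar : Fstar = ⨅ x, F x) (hFstarBot : ⊥ < Fstar) :
    Filter.Tendsto (fun k => ‖gradMap γ gradD prox (s k)‖) Filter.atTop (nhds 0) ∧
      Filter.Tendsto (fun k => ‖s k - f k‖) Filter.atTop (nhds 0) := by
  have hmin : ∀ k z, R (f (k + 1)) + ((1 / (2 * γ) *
      ‖f (k + 1) - (s (k + 1) - γ • gradD (s (k + 1)))‖ ^ 2 : ℝ) : EReal) ≤
      R z + ((1 / (2 * γ) * ‖z - (s (k + 1) - γ • gradD (s (k + 1)))‖ ^ 2 : ℝ) : EReal) :=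
    fun k => (hprox _ _).1 (hfk (k + 1) (by omega))
  have hRtop : ∀ k, R (f k) ≠ ⊤ := by
    rintro (_ | k) htop
    · exact hF0 (by rw [hF, htop, EReal.coe_add_top])
    · obtain ⟨z, hz⟩ := hRproper
      have h := hmin k z
      rw [htop, EReal.top_add_coe, top_le_iff] at h
      exact EReal.add_ne_top hz (EReal.coe_ne_top _) h
  have hr : ∀ k, R (f k) = ((R (f k)).toReal : EReal) :=
    fun k => (EReal.coe_toReal (hRtop k) (hRbot _)).symm
  have hFle : ∀ k, Fstar ≤ ((D (f k) + (R (f k)).toReal : ℝ) : EReal) := by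
    intro k
    rw [EReal.coe_add, ← hr, ← hF, hFstar]
    exact iInf_le F (f k)
  have hFstarCoe : (Fstar.toReal : EReal) = Fstar :=
    EReal.coe_toReal (ne_top_of_le_ne_top (EReal.coe_ne_top _) (hFle 0)) hFstarBot.ne'
  have hlower : ∀ k, Fstar.toReal ≤ D (f k) + (R (f k)).toReal := by
    intro k
    rw [← EReal.coe_le_coe_iff, hFstarCoe]
    exact hFle k
  have hmom : ∀ k, ‖s (k + 1) - f k‖ ^ 2 ≤ α ^ 2 * ‖f k - f (k - 1)‖ ^ 2 := by
    rintro (_ | k)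
    · simp [hs1]
    · obtain ⟨hq0, hq1⟩ := fista_momentum_mem_Icc ht0 htrec (k + 1)
      rw [hsk (k + 1) (by omega), add_sub_cancel_left, norm_smul, mul_pow, Real.norm_eq_abs,
        sq_abs, mul_pow]
      exact mul_le_mul_of_nonneg_right
        (mul_le_of_le_one_right (sq_nonneg α) (pow_le_one₀ hq0 hq1)) (sq_nonneg _)
  have hγL : γ * L ≤ (1 - α ^ 2) / 2 := by
    rw [le_div_iff₀ (by positivity)] at hγ
    linarith
  have hα2 : α ^ 2 < 1 := pow_lt_one₀ hα0 hα1 two_ne_zero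
  have hc : 0 < 1 / (2 * γ) - L / 2 := by
    have : 1 / (2 * γ) - L / 2 = (1 - γ * L) / (2 * γ) := by field_simp
    rw [this]
    exact div_pos (by nlinarith [sq_nonneg α]) (by positivity)
  have hcoef : (1 / (2 * γ) + L / 2) * α ^ 2 ≤ 1 / (2 * γ) := by
    have : (1 / (2 * γ) + L / 2) * α ^ 2 = (1 + γ * L) * α ^ 2 / (2 * γ) := by field_simp
    rw [this]
    refine div_le_div_of_nonneg_right ?_ (by positivity)
    nlinarith [sq_nonneg α, mul_le_mul_of_nonneg_right hγL (sq_nonneg α)]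
  have hdecr : ∀ k, (D (f (k + 1)) + (R (f (k + 1))).toReal +
      1 / (2 * γ) * ‖f (k + 1) - f (k + 1 - 1)‖ ^ 2) +
      (1 / (2 * γ) - L / 2) * ‖s (k + 1) - f (k + 1)‖ ^ 2 ≤
      D (f k) + (R (f k)).toReal + 1 / (2 * γ) * ‖f k - f (k - 1)‖ ^ 2 := by
    intro k
    have hstep := prox_gradient_step_le hdiff hLip hRconvex hγ0 (hr (k + 1)) (hr k) (hmin k)
    have h1 := mul_le_mul_of_nonneg_left (hmom k)
      (show 0 ≤ 1 / (2 * γ) + L / 2 by positivity)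
    have h2 := mul_le_mul_of_nonneg_right hcoef (sq_nonneg ‖f k - f (k - 1)‖)
    rw [Nat.add_sub_cancel]
    linarith
  have hsq := tendsto_zero_of_le_decrement
    (V := fun k => D (f k) + (R (f k)).toReal + 1 / (2 * γ) * ‖f k - f (k - 1)‖ ^ 2)
    (fun k => (hlower k).trans (le_add_of_nonneg_right (by positivity)))
    (fun k => mul_nonneg hc.le (sq_nonneg ‖s (k + 1) - f (k + 1)‖)) hdecr
  have hres : Filter.Tendsto (fun k => ‖s k - f k‖) Filter.atTop (nhds 0) := by
    rw [← Filter.tendsto_add_atTop_iff_nat 1]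
    have h := (hsq.const_mul (1 / (2 * γ) - L / 2)⁻¹).sqrt
    simpa only [inv_mul_cancel_left₀ hc.ne', mul_zero, Real.sqrt_zero,
      Real.sqrt_sq (norm_nonneg _)] using h
  refine ⟨?_, hres⟩
  have hG := hres.const_mul γ⁻¹
  rw [mul_zero] at hG
  refine hG.congr' ?_
  filter_upwards [Filter.eventually_ge_atTop 1] with k hk
  rw [gradMap, ← hfk k hk, norm_smul, Real.norm_of_nonneg (inv_nonneg.2 hγ0.le)]
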